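/- arXiv:2601.12741 — 3 statements merged into one kernel-verified Lean document; each statement's English description precedes it below -/
import Mathlib

section
/- (Asymptotic Goodman bound.) For every limiting graph φ, φ(I_3) + φ(K_3) ≥ 1/4, where I_3 is the edgeless graph on vertex set [3] and K_3 is the complete graph on vertex set [3]. -/
open Filter Topology MeasureTheory

/-- A finite simple undirected graph with vertex set a finite subset of ℕ. -/
structure FGraph where
  verts : Finset ℕ
  Adj : ℕ → ℕ → Prop
  symm : ∀ a b, Adj a b → Adj b a
  irrefl : ∀ a, ¬ Adj a a
  mem : ∀ a b, Adj a b → a ∈ verts ∧ b ∈ verts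

namespace FGraph

/-- Induced subgraph on a set `U` of vertices. -/
def induce (G : FGraph) (U : Finset ℕ) : FGraph where
  verts := U
  Adj a b := a ∈ U ∧ b ∈ U ∧ G.Adj a b
  symm := fun a b ⟨ha, hb, h⟩ => ⟨hb, ha, G.symm a b h⟩
  irrefl := fun a ⟨_, _, h⟩ => G.irrefl a h
  mem := fun _ _ ⟨ha, hb, _⟩ => ⟨ha, hb⟩

/-- Graph isomorphism. -/
def Iso (H G : FGraph) : Prop :=
  ∃ f : ℕ → ℕ, Set.BijOn f ↑H.verts ↑G.verts ∧
    ∀ a ∈ H.verts, ∀ b ∈ H.verts, (H.Adj a b ↔ G.Adj (f a) (f b))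

-- /-- Induced subgraph density `p(H,G)`: the probability that a uniformly random
-- `v(H)`-element subset of `V(G)` induces a subgraph isomorphic to `H`.
-- (When `v(H) > v(G)` this is `0/0 = 0`, matching the convention.) -/
open Classical in
noncomputable def density (H G : FGraph) : ℝ :=
  (((G.verts.powersetCard H.verts.card).filter fun U => Iso H (G.induce U)).card : ℝ) /
    ((G.verts.powersetCard H.verts.card).card : ℝ)

/-- Build a graph on vertex set `V` from an arbitrary relation (symmetrised, loops removed). -/
def ofRel (V : Finset ℕ) (r : ℕ → ℕ → Prop) : FGraph where
  verts := V
  Adj a b := a ∈ V ∧ b ∈ V ∧ a ≠ b ∧ (r a b ∨ r b a)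
  symm := fun _ _ ⟨ha, hb, hne, hr⟩ => ⟨hb, ha, hne.symm, hr.symm⟩
  irrefl := fun _ ⟨_, _, hne, _⟩ => hne rfl
  mem := fun _ _ ⟨ha, hb, _, _⟩ => ⟨ha, hb⟩

/-- The complete graph `K_t` on vertex set `[t] = {1,…,t}`. -/
def completeG (t : ℕ) : FGraph := ofRel (Finset.Icc 1 t) fun _ _ => True

/-- The edgeless graph `I_t` on vertex set `[t] = {1,…,t}`. -/
def edgeless (t : ℕ) : FGraph := ofRel (Finset.Icc 1 t) fun _ _ => False

/-- The graph on `[3]` with exactly one edge `{1,2}`. -/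
def oneEdge3 : FGraph := ofRel (Finset.Icc 1 3) fun a b => a = 1 ∧ b = 2

/-- The path with two edges `{1,2},{2,3}` on `[3]`. -/
def path3 : FGraph := ofRel (Finset.Icc 1 3) fun a b => (a = 1 ∧ b = 2) ∨ (a = 2 ∧ b = 3)

/-- The graph with empty vertex set. -/
def emptyG : FGraph := ofRel ∅ fun _ _ => False

/-- The complement graph. -/
def compl (G : FGraph) : FGraph := ofRel G.verts fun a b => ¬ G.Adj a b

end FGraph

/-- `𝓗` is a complete set of graphs on `V`: every graph with vertex set `V`
is isomorphic to exactly one member of `𝓗`, and all members have vertex set `V`. -/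
def CompleteOn (V : Finset ℕ) (𝓗 : Finset FGraph) : Prop :=
  (∀ H ∈ 𝓗, H.verts = V) ∧
  ∀ G : FGraph, G.verts = V → ∃! H, H ∈ 𝓗 ∧ FGraph.Iso G H

/-- An increasing sequence of graphs. -/
def IncreasingSeq (Gs : ℕ → FGraph) : Prop :=
  ∀ n, (Gs n).verts.card < (Gs (n + 1)).verts.card

/-- `φ` is a limiting graph: the pointwise limit of densities along some
convergent (increasing) sequence of graphs. -/
def IsLimitGraph (φ : FGraph → ℝ) : Prop :=
  ∃ Gs : ℕ → FGraph, IncreasingSeq Gs ∧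
    ∀ H : FGraph, Tendsto (fun n => FGraph.density H (Gs n)) atTop (𝓝 (φ H))

-- /-- `r_H` in the product decomposition: the probability that uniformly random
-- disjoint subsets `U₁, U₂` of `V(H)` of sizes `v(H₁)`, `v(H₂)` induce copies of
-- `H₁` and `H₂` respectively. -/
open Classical in
noncomputable def rval (H H1 H2 : FGraph) : ℝ :=
  let S := ((H.verts.powersetCard H1.verts.card) ×ˢ (H.verts.powersetCard H2.verts.card)).filter
      fun p => Disjoint p.1 p.2
  ((S.filter fun p => FGraph.Iso H1 (H.induce p.1) ∧ FGraph.Iso H2 (H.induce p.2)).card : ℝ) /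
    (S.card : ℝ)

-- `θ` is an embedding of the type `τ` into `G`. -/
def IsEmbOf (τ G : FGraph) (θ : ℕ → ℕ) : Prop :=
  (∀ i ∈ τ.verts, θ i ∈ G.verts) ∧ Set.InjOn θ ↑τ.verts ∧
  ∀ i ∈ τ.verts, ∀ j ∈ τ.verts, (τ.Adj i j ↔ G.Adj (θ i) (θ j))

/-- A `τ`-labelled graph: a graph together with an embedding of `τ` into it. -/
structure LGraph (τ : FGraph) where
  G : FGraph
  θ : ℕ → ℕ
  emb : IsEmbOf τ G θ

/-- `τ`-isomorphism of labelled graphs, expressed on the underlying data. -/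
def LIsoPair (τ : FGraph) (H : FGraph) (ι : ℕ → ℕ) (G : FGraph) (θ : ℕ → ℕ) : Prop :=
  ∃ f : ℕ → ℕ, Set.BijOn f ↑H.verts ↑G.verts ∧
    (∀ a ∈ H.verts, ∀ b ∈ H.verts, (H.Adj a b ↔ G.Adj (f a) (f b))) ∧
    ∀ i ∈ τ.verts, f (ι i) = θ i

/-- `τ`-isomorphism of two `τ`-labelled graphs. -/
def LIso {τ : FGraph} (Hτ Gτ : LGraph τ) : Prop :=
  LIsoPair τ Hτ.G Hτ.θ Gτ.G Gτ.θ

-- /-- The labelled density `p_τ(H^τ, G^τ)`. -/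
open Classical in
noncomputable def ldensity {τ : FGraph} (Hτ Gτ : LGraph τ) : ℝ :=
  ((((Gτ.G.verts \ τ.verts.image Gτ.θ).powersetCard
        (Hτ.G.verts.card - τ.verts.card)).filter
      fun U => LIsoPair τ Hτ.G Hτ.θ (Gτ.G.induce (τ.verts.image Gτ.θ ∪ U)) Gτ.θ).card : ℝ) /
    (((Gτ.G.verts \ τ.verts.image Gτ.θ).powersetCard
        (Hτ.G.verts.card - τ.verts.card)).card : ℝ)

/-- A `τ`-labelled limiting graph. -/
def IsLimitLGraph {τ : FGraph} (φ : LGraph τ → ℝ) : Prop :=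
  ∃ Gs : ℕ → LGraph τ, (∀ n, (Gs n).G.verts.card < (Gs (n + 1)).G.verts.card) ∧
    ∀ Hτ : LGraph τ, Tendsto (fun n => ldensity Hτ (Gs n)) atTop (𝓝 (φ Hτ))

/-- `𝓗` is a complete set of `τ`-labelled graphs on `V`. -/
def LCompleteOn (τ : FGraph) (V : Finset ℕ) (𝓗 : Finset (LGraph τ)) : Prop :=
  (∀ Hτ ∈ 𝓗, Hτ.G.verts = V) ∧
  ∀ Gτ : LGraph τ, Gτ.G.verts = V → ∃! Hτ, Hτ ∈ 𝓗 ∧ LIso Gτ Hτ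

/-- The `τ`-labelled graph `(τ, id)`. -/
def idLabel (τ : FGraph) : LGraph τ :=
  ⟨τ, id, fun _ hi => hi, Set.injOn_id _, fun _ _ _ _ => Iff.rfl⟩

-- /-- The labelled analogue of `rval`. -/
open Classical in
noncomputable def rvalL {τ : FGraph} (Gτ H1 H2 : LGraph τ) : ℝ :=
  let S := ((Gτ.G.verts \ τ.verts.image Gτ.θ).powersetCard (H1.G.verts.card - τ.verts.card) ×ˢ
      (Gτ.G.verts \ τ.verts.image Gτ.θ).powersetCard (H2.G.verts.card - τ.verts.card)).filter
      fun p => Disjoint p.1 p.2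
  ((S.filter fun p =>
      LIsoPair τ H1.G H1.θ (Gτ.G.induce (τ.verts.image Gτ.θ ∪ p.1)) Gτ.θ ∧
      LIsoPair τ H2.G H2.θ (Gτ.G.induce (τ.verts.image Gτ.θ ∪ p.2)) Gτ.θ).card : ℝ) /
    (S.card : ℝ)

/-- Extend a function between Finset-subtypes to a function `ℕ → ℕ`. -/
def toFun {V W : Finset ℕ} (f : ↥V → ↥W) : ℕ → ℕ :=
  fun i => if h : i ∈ V then (f ⟨i, h⟩ : ℕ) else 0

-- /-- `q_{G^τ}`: the probability that a uniformly random injection `θ : [k] → V(|G^τ|)`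
-- is an embedding of `τ` with `(|G^τ|, θ) ≅_τ G^τ`. -/
open Classical in
noncomputable def qval {τ : FGraph} (Gτ : LGraph τ) : ℝ :=
  (Fintype.card {f : ↥τ.verts ↪ ↥Gτ.G.verts //
      IsEmbOf τ Gτ.G (toFun ⇑f) ∧ LIsoPair τ Gτ.G (toFun ⇑f) Gτ.G Gτ.θ} : ℝ) /
  (Fintype.card (↥τ.verts ↪ ↥Gτ.G.verts) : ℝ)

-- /-- The number of embeddings of `τ` into `G`. -/
open Classical in
noncomputable def embCard (τ G : FGraph) : ℕ :=
  Fintype.card {f : ↥τ.verts ↪ ↥G.verts // IsEmbOf τ G (toFun ⇑f)}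

-- /-- The number of automorphisms of `G`. -/
open Classical in
noncomputable def autCard (G : FGraph) : ℕ :=
  Fintype.card {f : ↥G.verts ≃ ↥G.verts //
    ∀ a b : ↥G.verts, G.Adj a b ↔ G.Adj (f a) (f b)}

/-- Build a `τ`-labelled graph from an embedding. -/
def LGraph.mk' (τ G : FGraph) (θ : ℕ → ℕ) (h : IsEmbOf τ G θ) : LGraph τ := ⟨G, θ, h⟩

instance : MeasurableSpace FGraph := ⊤
instance (τ : FGraph) : MeasurableSpace (LGraph τ) := ⊤
noncomputable instance (τ : FGraph) :
    MeasurableSpace {ψ : LGraph τ → ℝ // IsLimitLGraph ψ} := borel _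


namespace FGraph

/-- A graph on `[3]` is isomorphic to the subgraph induced on three distinct vertices as soon as
the three adjacencies agree. -/
lemma iso_induce_triple {H G : FGraph} (hH : H.verts = {1, 2, 3}) {a b c : ℕ}
    (h1 : a ≠ b) (h2 : b ≠ c) (h3 : a ≠ c) (hab : H.Adj 1 2 ↔ G.Adj a b)
    (hbc : H.Adj 2 3 ↔ G.Adj b c) (hac : H.Adj 1 3 ↔ G.Adj a c) :
    Iso H (G.induce {a, b, c}) := by
  have hH' : ∀ x y, H.Adj x y ↔ H.Adj y x := fun x y => ⟨H.symm x y, H.symm y x⟩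
  have hG' : ∀ x y, G.Adj x y ↔ G.Adj y x := fun x y => ⟨G.symm x y, G.symm y x⟩
  have hba : H.Adj 2 1 ↔ G.Adj b a := by rw [hH', hab, hG']
  have hcb : H.Adj 3 2 ↔ G.Adj c b := by rw [hH', hbc, hG']
  have hca : H.Adj 3 1 ↔ G.Adj c a := by rw [hH', hac, hG']
  refine ⟨fun i => if i = 1 then a else if i = 2 then b else c, ⟨?_, ?_, ?_⟩, ?_⟩
  · intro i hi
    simp only [induce, hH, Finset.mem_coe, Finset.mem_insert, Finset.mem_singleton] at hi ⊢
    rcases hi with rfl | rfl | rfl <;> simp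
  · intro i hi j hj
    simp only [hH, Finset.mem_coe, Finset.mem_insert, Finset.mem_singleton] at hi hj ⊢
    rcases hi with rfl | rfl | rfl <;> rcases hj with rfl | rfl | rfl <;>
      simp [h1, h2, h3, h1.symm, h2.symm, h3.symm]
  · intro x hx
    simp only [induce, Finset.mem_coe, Finset.mem_insert, Finset.mem_singleton] at hx
    rcases hx with rfl | rfl | rfl
    · exact ⟨1, by simp [hH]⟩
    · exact ⟨2, by simp [hH]⟩
    · exact ⟨3, by simp [hH]⟩
  · intro i hi j hj
    simp only [hH, Finset.mem_insert, Finset.mem_singleton] at hi hj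
    rcases hi with rfl | rfl | rfl <;> rcases hj with rfl | rfl | rfl <;>
      simp [induce, hab, hbc, hac, hba, hcb, hca, G.irrefl, H.irrefl]

/-- The ordered triple `(a, b, c)` consists of distinct vertices spanning a clique or an
independent set. -/
def IsMonoTriple (G : FGraph) (a b c : ℕ) : Prop :=
  a ≠ b ∧ b ≠ c ∧ a ≠ c ∧
    ((G.Adj a b ∧ G.Adj b c ∧ G.Adj a c) ∨ (¬ G.Adj a b ∧ ¬ G.Adj b c ∧ ¬ G.Adj a c))

open Classical in
/-- `1` on edges, `-1` on non-edges, `0` on the diagonal. -/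
noncomputable def edgeSign (G : FGraph) (a b : ℕ) : ℝ :=
  if a = b then 0 else if G.Adj a b then 1 else -1

open Classical in
lemma edgeSign_comm (G : FGraph) (a b : ℕ) : G.edgeSign a b = G.edgeSign b a :=
  if_congr eq_comm rfl (if_congr ⟨G.symm a b, G.symm b a⟩ rfl rfl)

open Classical in
lemma edgeSign_sum_le_indicator (G : FGraph) (a b c : ℕ) :
    1 + (G.edgeSign a b * G.edgeSign b c + G.edgeSign b c * G.edgeSign c a
      + G.edgeSign c a * G.edgeSign a b) ≤
    4 * (if G.IsMonoTriple a b c then 1 else 0) +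
      2 * ((if a = b then 1 else 0) + (if b = c then 1 else 0) + (if c = a then 1 else 0)) := by
  rw [G.edgeSign_comm c a]
  unfold edgeSign IsMonoTriple
  by_cases h1 : a = b
  · subst h1
    by_cases h2 : a = c
    · subst h2; norm_num
    · by_cases h : G.Adj a c <;> simp [h, h2, Ne.symm h2] <;> norm_num
  · by_cases h2 : b = c
    · subst h2
      by_cases h : G.Adj a b <;> simp [h, h1, Ne.symm h1] <;> norm_num
    · by_cases h3 : a = c
      · subst h3
        by_cases h : G.Adj a b <;> by_cases h' : G.Adj b a <;>
          simp [h, h', h1, h2] <;> norm_num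
      · by_cases h : G.Adj a b <;> by_cases h' : G.Adj b c <;> by_cases h'' : G.Adj a c <;>
          simp [h, h', h'', h1, h2, h3, Ne.symm h3] <;> norm_num

lemma sum_edgeSign_mul_nonneg (G : FGraph) (V : Finset ℕ) :
    0 ≤ ∑ a ∈ V, ∑ b ∈ V, ∑ c ∈ V, G.edgeSign a b * G.edgeSign b c := by
  rw [Finset.sum_comm]
  refine Finset.sum_nonneg fun b _ => ?_
  have h : ∑ a ∈ V, ∑ c ∈ V, G.edgeSign a b * G.edgeSign b c
      = (∑ c ∈ V, G.edgeSign b c) * (∑ c ∈ V, G.edgeSign b c) := by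
    rw [Finset.sum_mul_sum]
    simp only [G.edgeSign_comm _ b]
  rw [h]
  exact mul_self_nonneg _

open Classical in
/-- The monochromatic ordered triples of a graph. -/
noncomputable def monoTriples (G : FGraph) : Finset (ℕ × ℕ × ℕ) :=
  (G.verts ×ˢ G.verts ×ˢ G.verts).filter fun t => G.IsMonoTriple t.1 t.2.1 t.2.2

lemma le_card_monoTriples (G : FGraph) :
    (G.verts.card : ℝ) ^ 3 - 6 * (G.verts.card : ℝ) ^ 2 ≤ 4 * (G.monoTriples.card : ℝ) := by
  classical
  set V := G.verts with hV
  have hsum := Finset.sum_le_sum fun a (_ : a ∈ V) => Finset.sum_le_sum fun b (_ : b ∈ V) =>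
    Finset.sum_le_sum fun c (_ : c ∈ V) => G.edgeSign_sum_le_indicator a b c
  have hcard : (G.monoTriples.card : ℝ) =
      ∑ a ∈ V, ∑ b ∈ V, ∑ c ∈ V, if G.IsMonoTriple a b c then (1 : ℝ) else 0 := by
    simp only [monoTriples, Finset.card_filter, Finset.sum_product, Nat.cast_sum, Nat.cast_ite,
      Nat.cast_one, Nat.cast_zero, ← hV]
  have n1 := G.sum_edgeSign_mul_nonneg V
  have n2 : 0 ≤ ∑ a ∈ V, ∑ b ∈ V, ∑ c ∈ V, G.edgeSign b c * G.edgeSign c a := by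
    refine n1.trans_eq ?_
    rw [Finset.sum_comm_cycle]
  have n3 : 0 ≤ ∑ a ∈ V, ∑ b ∈ V, ∑ c ∈ V, G.edgeSign c a * G.edgeSign a b := by
    refine n1.trans_eq ?_
    rw [← Finset.sum_comm_cycle]
  have e1 : ∑ a ∈ V, ∑ b ∈ V, ∑ c ∈ V, (if a = b then (1 : ℝ) else 0) = (V.card : ℝ) ^ 2 := by
    simp [sq]
  have e2 : ∑ a ∈ V, ∑ b ∈ V, ∑ c ∈ V, (if b = c then (1 : ℝ) else 0) = (V.card : ℝ) ^ 2 := by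
    simp [sq]
  have e3 : ∑ a ∈ V, ∑ b ∈ V, ∑ c ∈ V, (if c = a then (1 : ℝ) else 0) = (V.card : ℝ) ^ 2 := by
    simp [sq]
  have e0 : ∑ a ∈ V, ∑ b ∈ V, ∑ c ∈ V, (1 : ℝ) = (V.card : ℝ) ^ 3 := by
    simp; ring
  simp only [Finset.sum_add_distrib, ← Finset.mul_sum] at hsum n1 n2 n3
  simp only [Finset.mul_sum] at hsum n1 n2 n3
  simp only [← Finset.mul_sum, e0, e1, e2, e3, ← hcard] at hsum n1 n2 n3
  linarith

lemma card_monoTriples_le (G : FGraph) (S : Finset (Finset ℕ))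
    (hS : ∀ a ∈ G.verts, ∀ b ∈ G.verts, ∀ c ∈ G.verts, G.IsMonoTriple a b c → {a, b, c} ∈ S)
    (hS3 : ∀ U ∈ S, U.card = 3) :
    G.monoTriples.card ≤ 6 * S.card := by
  classical
  refine Finset.card_le_mul_card_image_of_maps_to
    (f := fun t : ℕ × ℕ × ℕ => ({t.1, t.2.1, t.2.2} : Finset ℕ)) ?_ 6 ?_
  · rintro ⟨a, b, c⟩ ht
    simp only [monoTriples, Finset.mem_filter, Finset.mem_product] at ht
    exact hS a ht.1.1 b ht.1.2.1 c ht.1.2.2 ht.2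
  · intro U hU
    obtain ⟨x, y, z, hxy, hxz, hyz, rfl⟩ := Finset.card_eq_three.1 (hS3 U hU)
    refine (Finset.card_le_card (t := {(x, y, z), (x, z, y), (y, x, z), (y, z, x), (z, x, y),
      (z, y, x)}) ?_).trans Finset.card_le_six
    rintro ⟨a, b, c⟩ ht
    obtain ⟨ht, h⟩ := Finset.mem_filter.1 ht
    obtain ⟨-, h1, h2, h3, -⟩ := Finset.mem_filter.1 ht
    have ha : a ∈ ({x, y, z} : Finset ℕ) := by rw [← h]; simp
    have hb : b ∈ ({x, y, z} : Finset ℕ) := by rw [← h]; simp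
    have hc : c ∈ ({x, y, z} : Finset ℕ) := by rw [← h]; simp
    simp only [Finset.mem_insert, Finset.mem_singleton, Prod.mk.injEq] at ha hb hc ⊢
    clear h hU
    grind

/-- The finite Goodman bound, up to lower-order terms. -/
lemma density_edgeless_add_completeG_ge (G : FGraph) (hG : 6 ≤ G.verts.card) :
    1 / 4 * (1 - 6 / (G.verts.card : ℝ)) ≤ density (edgeless 3) G + density (completeG 3) G := by
  classical
  have hI : (edgeless 3).verts.card = 3 := rfl
  have hK : (completeG 3).verts.card = 3 := rfl
  unfold density
  rw [hI, hK, ← add_div]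
  set A := (G.verts.powersetCard 3).filter fun U => Iso (edgeless 3) (G.induce U) with hA
  set B := (G.verts.powersetCard 3).filter fun U => Iso (completeG 3) (G.induce U) with hB
  have hT : G.monoTriples.card ≤ 6 * (A ∪ B).card := by
    refine G.card_monoTriples_le _ ?_ ?_
    · rintro a ha b hb c hc ⟨h1, h2, h3, h⟩
      have hmem : ({a, b, c} : Finset ℕ) ∈ G.verts.powersetCard 3 := by
        rw [Finset.mem_powersetCard]
        refine ⟨?_, Finset.card_eq_three.2 ⟨a, b, c, h1, h3, h2, rfl⟩⟩
        intro x hx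
        simp only [Finset.mem_insert, Finset.mem_singleton] at hx
        rcases hx with rfl | rfl | rfl <;> assumption
      rw [Finset.mem_union, hA, hB, Finset.mem_filter, Finset.mem_filter]
      rcases h with ⟨u, v, w⟩ | ⟨u, v, w⟩
      · exact Or.inr ⟨hmem, iso_induce_triple (by decide) h1 h2 h3 (by simp [completeG, ofRel, u])
          (by simp [completeG, ofRel, v]) (by simp [completeG, ofRel, w])⟩
      · exact Or.inl ⟨hmem, iso_induce_triple (by decide) h1 h2 h3 (by simp [edgeless, ofRel, u])
          (by simp [edgeless, ofRel, v]) (by simp [edgeless, ofRel, w])⟩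
    · intro U hU
      rw [Finset.mem_union, hA, hB, Finset.mem_filter, Finset.mem_filter] at hU
      exact (Finset.mem_powersetCard.1 (hU.elim And.left And.left)).2
  have hT' : (G.monoTriples.card : ℝ) ≤ 6 * ((A.card : ℝ) + B.card) := by
    exact_mod_cast hT.trans (Nat.mul_le_mul_left 6 (Finset.card_union_le A B))
  have hlow := G.le_card_monoTriples
  rw [Finset.card_powersetCard]
  set n := G.verts.card
  have hn : (6 : ℝ) ≤ n := by exact_mod_cast hG
  have hpos : (0 : ℝ) < n.choose 3 := by exact_mod_cast Nat.choose_pos (by omega)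
  have hchoose : (n.choose 3 : ℝ) ≤ (n : ℝ) ^ 3 / 6 := by
    simpa [Nat.factorial] using Nat.choose_le_pow_div (α := ℝ) 3 n
  rw [le_div_iff₀ hpos]
  have hfac : 0 ≤ 1 - 6 / (n : ℝ) := by
    rw [sub_nonneg, div_le_one (by linarith)]; exact hn
  calc 1 / 4 * (1 - 6 / (n : ℝ)) * (n.choose 3 : ℝ)
      ≤ 1 / 4 * (1 - 6 / (n : ℝ)) * ((n : ℝ) ^ 3 / 6) := by gcongr
    _ = ((n : ℝ) ^ 3 - 6 * (n : ℝ) ^ 2) / 24 := by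
        have : (n : ℝ) ≠ 0 := by linarith
        field_simp; ring
    _ ≤ (A.card : ℝ) + B.card := by linarith

end FGraph

theorem asymptotic_goodman (φ : FGraph → ℝ) (hφ : IsLimitGraph φ) :
    φ (FGraph.edgeless 3) + φ (FGraph.completeG 3) ≥ 1 / 4 := by
  obtain ⟨Gs, hinc, hlim⟩ := hφ
  have hcard : Tendsto (fun n => (Gs n).verts.card) atTop atTop :=
    (strictMono_nat_of_lt_succ hinc).tendsto_atTop
  have hbound : Tendsto (fun n => 1 / 4 * (1 - 6 / ((Gs n).verts.card : ℝ))) atTop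
      (𝓝 (1 / 4)) := by
    have h := (tendsto_natCast_atTop_atTop (R := ℝ)).comp hcard
    simpa using ((h.const_div_atTop 6).const_sub 1).const_mul (1 / 4 : ℝ)
  refine le_of_tendsto_of_tendsto hbound
    ((hlim (FGraph.edgeless 3)).add (hlim (FGraph.completeG 3))) ?_
  filter_upwards [hcard.eventually_ge_atTop 6] with n hn
  exact (Gs n).density_edgeless_add_completeG_ge hn
end

section
/- Let τ be a type of size k, let V ⊆ ℕ be finite with |V| ≥ k, and let 𝓗^τ be a set of τ-labelled graphs with underlying vertex set V such that every τ-labelled graph with underlying vertex set V is τ-isomorphic to exactly one element of 𝓗^τ. Let H_1^τ, H_2^τ be τ-labelled graphs with v(H_1^τ) + v(H_2^τ) − k ≤ |V|. For each (H,θ) ∈ 𝓗^τ, let r_{(H,θ)} be the probability that, for uniformly random disjoint subsets U_1, U_2 of V(H)∖θ([k]) of sizes v(H_1^τ)−k and v(H_2^τ)−k respectively, (H[θ([k]) ∪ U_1], θ) ≅_τ H_1^τ and (H[θ([k]) ∪ U_2], θ) ≅_τ H_2^τ. Then for every τ-labelled limiting graph φ, φ(H_1^τ)·φ(H_2^τ)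 = Σ_{(H,θ) ∈ 𝓗^τ} r_{(H,θ)}·φ((H,θ)). -/
open Filter Topology MeasureTheory

open Classical in
/-- The disjoint pairs of subsets of `R` of sizes `a` and `b`. -/
noncomputable def disjPairs (R : Finset ℕ) (a b : ℕ) : Finset (Finset ℕ × Finset ℕ) :=
  (R.powersetCard a ×ˢ R.powersetCard b).filter fun p => Disjoint p.1 p.2

lemma mem_disjPairs {R : Finset ℕ} {a b : ℕ} {p : Finset ℕ × Finset ℕ} :
    p ∈ disjPairs R a b ↔ ((p.1 ⊆ R ∧ p.1.card = a) ∧ p.2 ⊆ R ∧ p.2.card = b) ∧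
      Disjoint p.1 p.2 := by
  simp [disjPairs, Finset.mem_powersetCard]

lemma card_disjPairs (R : Finset ℕ) (a b : ℕ) :
    (disjPairs R a b).card = R.card.choose a * (R.card - a).choose b := by
  have h : disjPairs R a b = (R.powersetCard a).biUnion fun U =>
      ((R \ U).powersetCard b).image fun W => (U, W) := by
    ext ⟨U, W⟩
    simp only [mem_disjPairs, Finset.mem_biUnion, Finset.mem_image, Finset.mem_powersetCard,
      Prod.mk.injEq, Finset.subset_sdiff]
    constructor
    · rintro ⟨⟨h1, h2⟩, h3⟩
      exact ⟨U, h1, W, ⟨⟨h2.1, h3.symm⟩, h2.2⟩, rfl, rfl⟩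
    · rintro ⟨U', h1, W', ⟨⟨h2, h3⟩, h4⟩, rfl, rfl⟩
      exact ⟨⟨h1, h2, h4⟩, h3.symm⟩
  rw [h, Finset.card_biUnion, Finset.sum_congr rfl (g := fun _ => (R.card - a).choose b)]
  · simp
  · intro U hU
    rw [Finset.mem_powersetCard] at hU
    rw [Finset.card_image_of_injective _ (Prod.mk_right_injective U), Finset.card_powersetCard,
      Finset.card_sdiff_of_subset hU.1, hU.2]
  · intro U _ U' _ hne
    rw [Function.onFun, Finset.disjoint_left]
    simp only [Finset.mem_image]
    rintro _ ⟨W, _, rfl⟩ ⟨W', _, h⟩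
    exact hne (Prod.mk.inj h).1.symm

lemma sum_card_filter_disjPairs (R : Finset ℕ) {a b m : ℕ} (hab : a + b ≤ m)
    (P : Finset ℕ × Finset ℕ → Prop) [DecidablePred P] :
    ∑ W ∈ R.powersetCard m, ((disjPairs W a b).filter P).card =
      ((disjPairs R a b).filter P).card * (R.card - (a + b)).choose (m - (a + b)) := by
  have key := Finset.sum_card_bipartiteAbove_eq_sum_card_bipartiteBelow
    (s := R.powersetCard m) (t := (disjPairs R a b).filter P)
    (fun W p => p.1 ∪ p.2 ⊆ W)
  rw [Finset.sum_congr rfl (g := fun _ => (R.card - (a + b)).choose (m - (a + b)))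
    (s₁ := (disjPairs R a b).filter P), Finset.sum_const, smul_eq_mul] at key
  · rw [← key]
    refine Finset.sum_congr rfl fun W hW => ?_
    rw [Finset.mem_powersetCard] at hW
    congr 1
    ext p
    simp only [Finset.mem_filter, mem_disjPairs, Finset.mem_bipartiteAbove, Finset.union_subset_iff]
    constructor
    · rintro ⟨⟨⟨h1, h2⟩, h3⟩, h4⟩
      exact ⟨⟨⟨⟨⟨h1.1.trans hW.1, h1.2⟩, h2.1.trans hW.1, h2.2⟩, h3⟩, h4⟩, h1.1, h2.1⟩
    · rintro ⟨⟨⟨⟨h1, h2⟩, h3⟩, h4⟩, h5, h6⟩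
      exact ⟨⟨⟨⟨h5, h1.2⟩, h6, h2.2⟩, h3⟩, h4⟩
  · intro p hp
    simp only [Finset.mem_filter, mem_disjPairs] at hp
    obtain ⟨⟨⟨h1, h2⟩, h3⟩, -⟩ := hp
    have hcard : (p.1 ∪ p.2).card = a + b := by
      rw [Finset.card_union_of_disjoint h3, h1.2, h2.2]
    rw [Finset.bipartiteBelow, Finset.card_filter_powersetCard_subset _ _ _
      (Finset.union_subset h1.1 h2.1) (hcard.trans_le hab), hcard]

lemma LIsoPair.trans {τ A B C : FGraph} {α β γ : ℕ → ℕ} (h : LIsoPair τ A α B β)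
    (h' : LIsoPair τ B β C γ) : LIsoPair τ A α C γ := by
  obtain ⟨f, hf, hfa, hfi⟩ := h
  obtain ⟨g, hg, hga, hgi⟩ := h'
  refine ⟨g ∘ f, hg.comp hf, fun a ha b hb => ?_, fun i hi => ?_⟩
  · rw [hfa a ha b hb, hga _ (hf.mapsTo ha) _ (hf.mapsTo hb)]
    rfl
  · simp [hfi i hi, hgi i hi]

lemma LIso.symm {τ : FGraph} {A B : LGraph τ} (h : LIso A B) : LIso B A := by
  obtain ⟨f, hf, hfa, hfi⟩ := h
  have hinv := hf.invOn_invFunOn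
  have hb := Set.BijOn.symm hinv.symm hf
  refine ⟨Function.invFunOn f ↑A.G.verts, hb, fun a ha b hb' => ?_, fun i hi => ?_⟩
  · rw [hfa _ (hb.mapsTo ha) _ (hb.mapsTo hb'), hinv.2 ha, hinv.2 hb']
  · rw [← hfi i hi]
    exact hinv.1 (A.emb.1 i hi)

lemma LIso.trans {τ : FGraph} {A B C : LGraph τ} (h : LIso A B) (h' : LIso B C) : LIso A C :=
  LIsoPair.trans h h'

lemma LGraph.image_subset {τ : FGraph} (A : LGraph τ) : τ.verts.image A.θ ⊆ A.G.verts := by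
  intro x hx
  obtain ⟨i, hi, rfl⟩ := Finset.mem_image.1 hx
  exact A.emb.1 i hi

lemma LGraph.card_image {τ : FGraph} (A : LGraph τ) :
    (τ.verts.image A.θ).card = τ.verts.card :=
  Finset.card_image_of_injOn A.emb.2.1

lemma LGraph.card_le {τ : FGraph} (A : LGraph τ) : τ.verts.card ≤ A.G.verts.card :=
  A.card_image ▸ Finset.card_le_card A.image_subset

/-- The unlabelled vertices of a labelled graph. -/
def LGraph.free {τ : FGraph} (A : LGraph τ) : Finset ℕ := A.G.verts \ τ.verts.image A.θ

lemma LGraph.card_free {τ : FGraph} (A : LGraph τ) :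
    A.free.card = A.G.verts.card - τ.verts.card := by
  rw [LGraph.free, Finset.card_sdiff_of_subset A.image_subset, A.card_image]

/-- The labelled vertices of `A` together with `U` induce a copy of `H`. -/
def LGraph.Induces {τ : FGraph} (A H : LGraph τ) (U : Finset ℕ) : Prop :=
  LIsoPair τ H.G H.θ (A.G.induce (τ.verts.image A.θ ∪ U)) A.θ

lemma LGraph.Induces.map {τ : FGraph} {A B H : LGraph τ} {f : ℕ → ℕ}
    (hf : Set.BijOn f ↑A.G.verts ↑B.G.verts)
    (hfa : ∀ a ∈ A.G.verts, ∀ b ∈ A.G.verts, (A.G.Adj a b ↔ B.G.Adj (f a) (f b)))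
    (hfi : ∀ i ∈ τ.verts, f (A.θ i) = B.θ i) {U : Finset ℕ} (hU : U ⊆ A.G.verts)
    (h : A.Induces H U) : B.Induces H (U.image f) := by
  have hsub : τ.verts.image A.θ ∪ U ⊆ A.G.verts := Finset.union_subset A.image_subset hU
  have him : τ.verts.image B.θ ∪ U.image f = (τ.verts.image A.θ ∪ U).image f := by
    rw [Finset.image_union, Finset.image_image]
    congr 1
    exact Finset.image_congr fun i hi => (hfi i hi).symm
  refine LIsoPair.trans h ⟨f, ?_, ?_, hfi⟩
  · rw [him]
    simp only [FGraph.induce, Finset.coe_image]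
    exact (hf.injOn.mono (by exact_mod_cast hsub)).bijOn_image
  · intro a ha b hb
    have ha' := Finset.mem_image_of_mem f ha
    have hb' := Finset.mem_image_of_mem f hb
    rw [him]
    simp only [FGraph.induce] at ha hb ha' hb' ⊢
    simp only [ha, hb, ha', hb', true_and]
    exact hfa a (hsub ha) b (hsub hb)

open Classical in
lemma card_filter_induces_le {τ : FGraph} {A B : LGraph τ} (h : LIso A B) (H1 H2 : LGraph τ)
    (a b : ℕ) :
    ((disjPairs A.free a b).filter fun p => A.Induces H1 p.1 ∧ A.Induces H2 p.2).card ≤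
      ((disjPairs B.free a b).filter fun p => B.Induces H1 p.1 ∧ B.Induces H2 p.2).card := by
  obtain ⟨f, hf, hfa, hfi⟩ := h
  have hmap : ∀ U ⊆ A.free, U.image f ⊆ B.free ∧ (U.image f).card = U.card := by
    intro U hU
    refine ⟨fun y hy => ?_, Finset.card_image_of_injOn
      (hf.injOn.mono (by exact_mod_cast hU.trans Finset.sdiff_subset))⟩
    obtain ⟨x, hx, rfl⟩ := Finset.mem_image.1 hy
    have hx' := Finset.mem_sdiff.1 (hU hx)
    refine Finset.mem_sdiff.2 ⟨hf.mapsTo hx'.1, fun hc => hx'.2 ?_⟩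
    obtain ⟨i, hi, hix⟩ := Finset.mem_image.1 hc
    rw [← hfi i hi] at hix
    rw [← hf.injOn (A.emb.1 i hi) hx'.1 hix]
    exact Finset.mem_image_of_mem _ hi
  have hfree : A.free ⊆ A.G.verts := Finset.sdiff_subset
  have hinj : ∀ U ⊆ A.free, ∀ U' ⊆ A.free, U.image f = U'.image f → U = U' := by
    intro U hU U' hU' he
    have he' : f '' (U : Set ℕ) = f '' (U' : Set ℕ) := by
      simpa using congrArg (fun s : Finset ℕ => (s : Set ℕ)) he
    exact_mod_cast (hf.injOn.image_eq_image_iff (by exact_mod_cast hU.trans hfree)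
      (by exact_mod_cast hU'.trans hfree)).1 he'
  refine Finset.card_le_card_of_injOn (fun p => (p.1.image f, p.2.image f)) ?_ ?_
  · intro p hp
    simp only [Finset.coe_filter, Set.mem_ofPred_eq, mem_disjPairs] at hp ⊢
    obtain ⟨⟨⟨h1, h2⟩, h3⟩, h4, h5⟩ := hp
    refine ⟨⟨⟨⟨(hmap _ h1.1).1, (hmap _ h1.1).2.trans h1.2⟩, (hmap _ h2.1).1,
      (hmap _ h2.1).2.trans h2.2⟩, ?_⟩, h4.map hf hfa hfi (h1.1.trans hfree),
      h5.map hf hfa hfi (h2.1.trans hfree)⟩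
    rw [Finset.disjoint_left]
    intro y hy hy'
    obtain ⟨x, hx, rfl⟩ := Finset.mem_image.1 hy
    obtain ⟨x', hx', he⟩ := Finset.mem_image.1 hy'
    have := hf.injOn (hfree (h2.1 hx')) (hfree (h1.1 hx)) he
    exact Finset.disjoint_left.1 h3 hx (this ▸ hx')
  · intro p hp q hq he
    simp only [Finset.coe_filter, Set.mem_ofPred_eq, mem_disjPairs] at hp hq
    obtain ⟨⟨⟨h1, h2⟩, -⟩, -⟩ := hp
    obtain ⟨⟨⟨h1', h2'⟩, -⟩, -⟩ := hq
    obtain ⟨e1, e2⟩ := Prod.mk.inj he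
    exact Prod.ext (hinj _ h1.1 _ h1'.1 e1) (hinj _ h2.1 _ h2'.1 e2)

open Classical in
lemma rvalL_eq {τ : FGraph} (A H1 H2 : LGraph τ) :
    rvalL A H1 H2 =
      (((disjPairs A.free H1.free.card H2.free.card).filter
        fun p => A.Induces H1 p.1 ∧ A.Induces H2 p.2).card : ℝ) /
      ((disjPairs A.free H1.free.card H2.free.card).card : ℝ) := by
  rw [H1.card_free, H2.card_free]
  rfl

open Classical in
lemma ldensity_eq {τ : FGraph} (H A : LGraph τ) :
    ldensity H A = (((A.free.powersetCard H.free.card).filter (A.Induces H)).card : ℝ) /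
      (A.free.card.choose H.free.card : ℝ) := by
  rw [H.card_free, ← Finset.card_powersetCard]
  rfl

lemma rvalL_congr {τ : FGraph} {A B : LGraph τ} (h : LIso A B) (H1 H2 : LGraph τ) :
    rvalL A H1 H2 = rvalL B H1 H2 := by
  have hc : A.free.card = B.free.card := by
    obtain ⟨f, hf, -, -⟩ := h
    rw [A.card_free, B.card_free]
    congr 1
    have := Set.BijOn.ncard_eq hf
    simpa using this
  rw [rvalL_eq, rvalL_eq, card_disjPairs, card_disjPairs, hc,
    le_antisymm (card_filter_induces_le h H1 H2 _ _) (card_filter_induces_le h.symm H1 H2 _ _)]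

/-- The labelled subgraph of `A` induced by the labelled vertices and `W`. -/
def LGraph.sub {τ : FGraph} (A : LGraph τ) (W : Finset ℕ) : LGraph τ where
  G := A.G.induce (τ.verts.image A.θ ∪ W)
  θ := A.θ
  emb := by
    have h : ∀ i ∈ τ.verts, A.θ i ∈ τ.verts.image A.θ ∪ W := fun i hi =>
      Finset.mem_union_left _ (Finset.mem_image_of_mem _ hi)
    refine ⟨h, A.emb.2.1, fun i hi j hj => ?_⟩
    rw [A.emb.2.2 i hi j hj]
    exact ⟨fun hh => ⟨h i hi, h j hj, hh⟩, fun hh => hh.2.2⟩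

lemma LGraph.free_sub {τ : FGraph} (A : LGraph τ) {W : Finset ℕ} (hW : W ⊆ A.free) :
    (A.sub W).free = W := by
  have hd : Disjoint W (τ.verts.image A.θ) := (Finset.subset_sdiff.1 hW).2
  exact Finset.union_sdiff_cancel_left hd.symm

lemma LGraph.induces_sub {τ : FGraph} (A H : LGraph τ) {W U : Finset ℕ} (hU : U ⊆ W) :
    (A.sub W).Induces H U ↔ A.Induces H U := by
  have hsub : τ.verts.image A.θ ∪ U ⊆ τ.verts.image A.θ ∪ W :=
    Finset.union_subset_union_right hU
  have : (A.sub W).G.induce (τ.verts.image A.θ ∪ U) = A.G.induce (τ.verts.image A.θ ∪ U) := by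
    simp only [FGraph.induce, LGraph.sub, FGraph.mk.injEq, true_and]
    funext a b
    exact propext ⟨fun h => ⟨h.1, h.2.1, h.2.2.2.2⟩,
      fun h => ⟨h.1, h.2.1, hsub h.1, hsub h.2.1, h.2.2⟩⟩
  show LIsoPair _ _ _ ((A.sub W).G.induce (τ.verts.image A.θ ∪ U)) _ ↔ _
  rw [this]
  rfl

lemma LGraph.exists_lIso_verts {τ : FGraph} (A : LGraph τ) {V : Finset ℕ}
    (hV : A.G.verts.card = V.card) : ∃ B : LGraph τ, B.G.verts = V ∧ LIso A B := by
  obtain ⟨f, hf⟩ : ∃ f : ℕ → ℕ, Set.BijOn f ↑A.G.verts ↑V :=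
    Set.Finite.exists_bijOn_of_encard_eq (Finset.finite_toSet _) (by simp [hV])
  let g := Function.invFunOn f ↑A.G.verts
  have hg : ∀ a ∈ A.G.verts, g (f a) = a := fun a ha => hf.invOn_invFunOn.1 ha
  let G : FGraph :=
    { verts := V
      Adj := fun a b => a ∈ V ∧ b ∈ V ∧ A.G.Adj (g a) (g b)
      symm := fun a b h => ⟨h.2.1, h.1, A.G.symm _ _ h.2.2⟩
      irrefl := fun a h => A.G.irrefl _ h.2.2
      mem := fun a b h => ⟨h.1, h.2.1⟩ }
  have hadj : ∀ a ∈ A.G.verts, ∀ b ∈ A.G.verts, (A.G.Adj a b ↔ G.Adj (f a) (f b)) := by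
    intro a ha b hb
    have h1 : f a ∈ V := hf.mapsTo ha
    have h2 : f b ∈ V := hf.mapsTo hb
    simp only [G, h1, h2, true_and, hg a ha, hg b hb]
  refine ⟨⟨G, f ∘ A.θ, fun i hi => hf.mapsTo (A.emb.1 i hi),
    hf.injOn.comp A.emb.2.1 fun i hi => A.emb.1 i hi, fun i hi j hj => ?_⟩, rfl, f, hf, hadj,
    fun i _ => rfl⟩
  rw [A.emb.2.2 i hi j hj]
  exact hadj _ (A.emb.1 i hi) _ (A.emb.1 j hj)

lemma LCompleteOn.existsUnique {τ : FGraph} {V : Finset ℕ} {𝓗 : Finset (LGraph τ)}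
    (hc : LCompleteOn τ V 𝓗) (A : LGraph τ) (hV : A.G.verts.card = V.card) :
    ∃! H, H ∈ 𝓗 ∧ LIso H A := by
  obtain ⟨B, hB, hAB⟩ := A.exists_lIso_verts hV
  obtain ⟨H, ⟨hH, hBH⟩, huniq⟩ := hc.2 B hB
  exact ⟨H, ⟨hH, (hAB.trans hBH).symm⟩,
    fun H' h => huniq H' ⟨h.1, hAB.symm.trans h.2.symm⟩⟩

open Classical in
/-- The probability that a random disjoint pair of sets of unlabelled vertices of a large labelled
graph induces copies of `H1` and `H2` is the corresponding combination of densities. -/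
lemma sum_rvalL_mul_ldensity {τ : FGraph} {V : Finset ℕ} {𝓗 : Finset (LGraph τ)}
    (hc : LCompleteOn τ V 𝓗) (hV : τ.verts.card ≤ V.card) (H1 H2 A : LGraph τ)
    (hsz : H1.free.card + H2.free.card ≤ V.card - τ.verts.card)
    (hA : V.card - τ.verts.card ≤ A.free.card) :
    ∑ H ∈ 𝓗, rvalL H H1 H2 * ldensity H A = rvalL A H1 H2 := by
  set m := V.card - τ.verts.card
  set a := H1.free.card
  set b := H2.free.card
  have hfree : ∀ H ∈ 𝓗, H.free.card = m := fun H hH => by rw [H.card_free, hc.1 H hH]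
  set good := fun R : Finset ℕ =>
    ((disjPairs R a b).filter fun p => A.Induces H1 p.1 ∧ A.Induces H2 p.2).card with hgood
  have hsub : ∀ W ∈ A.free.powersetCard m,
      ∑ H ∈ 𝓗, (if A.Induces H W then rvalL H H1 H2 else 0) =
        (good W : ℝ) / (m.choose a * (m - a).choose b) := by
    intro W hW
    rw [Finset.mem_powersetCard] at hW
    have hcard : (A.sub W).G.verts.card = V.card := by
      have h1 := (A.sub W).card_free
      rw [A.free_sub hW.1, hW.2] at h1
      have h2 := (A.sub W).card_le
      omega
    obtain ⟨H, ⟨hH, hHW⟩, huniq⟩ := hc.existsUnique _ hcard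
    have hsum : ∑ H ∈ 𝓗, (if A.Induces H W then rvalL H H1 H2 else 0) = rvalL H H1 H2 :=
      (Finset.sum_eq_single_of_mem H hH fun H' hH' hne => if_neg fun hI => hne
        (huniq H' ⟨hH', hI⟩)).trans (if_pos hHW)
    rw [hsum, rvalL_congr hHW, rvalL_eq, A.free_sub hW.1, card_disjPairs, hW.2,
      Nat.cast_mul]
    congr 2
    refine congrArg Finset.card (Finset.filter_congr fun p hp => ?_)
    rw [mem_disjPairs] at hp
    rw [A.induces_sub H1 hp.1.1.1, A.induces_sub H2 hp.1.2.1]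
  have hlhs : ∑ H ∈ 𝓗, rvalL H H1 H2 * ldensity H A =
      (∑ W ∈ A.free.powersetCard m, (good W : ℝ)) /
        ((A.free.card.choose m : ℝ) * (m.choose a * (m - a).choose b)) := by
    rw [mul_comm (A.free.card.choose m : ℝ), ← div_div, Finset.sum_div,
      ← Finset.sum_congr rfl hsub, Finset.sum_comm, Finset.sum_div]
    refine Finset.sum_congr rfl fun H hH => ?_
    rw [ldensity_eq, hfree H hH, ← Finset.sum_filter, Finset.sum_const, nsmul_eq_mul]
    ring
  have hnum := sum_card_filter_disjPairs A.free hsz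
    fun p => A.Induces H1 p.1 ∧ A.Induces H2 p.2
  have hden := sum_card_filter_disjPairs A.free hsz fun _ => True
  simp only [Finset.filter_true, card_disjPairs] at hden
  rw [Finset.sum_congr rfl (g := fun _ => m.choose a * (m - a).choose b) fun W hW => by
    rw [(Finset.mem_powersetCard.1 hW).2], Finset.sum_const, smul_eq_mul,
    Finset.card_powersetCard] at hden
  rw [hlhs, rvalL_eq, card_disjPairs]
  have hpos : (((A.free.card - (a + b)).choose (m - (a + b)) : ℕ) : ℝ) ≠ 0 :=
    Nat.cast_ne_zero.2 (Nat.choose_pos (by omega)).ne'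
  have hnum' := congrArg (Nat.cast : ℕ → ℝ) hnum
  have hden' := congrArg (Nat.cast : ℕ → ℝ) hden
  push_cast at hnum' hden' ⊢
  simp only [hgood]
  rw [hden', hnum']
  exact mul_div_mul_right _ _ hpos

lemma abs_ldensity_mul_sub_rvalL_le {τ : FGraph} (H1 H2 A : LGraph τ)
    (hA : H1.free.card + H2.free.card ≤ A.free.card) :
    |ldensity H1 A * ldensity H2 A - rvalL A H1 H2| ≤
      1 - ((A.free.card - H1.free.card).choose H2.free.card : ℝ) /
        (A.free.card.choose H2.free.card : ℝ) := by
  classical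
  rw [ldensity_eq, ldensity_eq, rvalL_eq, card_disjPairs, div_mul_div_comm, ← Nat.cast_mul,
    ← Nat.cast_mul, ← Finset.card_product]
  set N := A.free.card
  set a := H1.free.card
  set b := H2.free.card
  set S := ((A.free.powersetCard a).filter (A.Induces H1)) ×ˢ
    ((A.free.powersetCard b).filter (A.Induces H2)) with hS
  set g := (disjPairs A.free a b).filter fun p => A.Induces H1 p.1 ∧ A.Induces H2 p.2 with hg
  have hgS : g ⊆ S := by
    intro p hp
    simp only [hg, hS, Finset.mem_filter, mem_disjPairs, Finset.mem_product,
      Finset.mem_powersetCard] at hp ⊢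
    tauto
  have hgt : g.card ≤ N.choose a * (N - a).choose b :=
    card_disjPairs A.free a b ▸ Finset.card_filter_le _ _
  have hST : (S \ g).card ≤ N.choose a * N.choose b - N.choose a * (N - a).choose b := by
    have h1 : disjPairs A.free a b ⊆ A.free.powersetCard a ×ˢ A.free.powersetCard b :=
      Finset.filter_subset _ _
    rw [← card_disjPairs A.free a b, ← Finset.card_powersetCard a A.free,
      ← Finset.card_powersetCard b A.free, ← Finset.card_product,
      ← Finset.card_sdiff_of_subset h1]
    refine Finset.card_le_card fun p hp => ?_
    simp only [hg, hS, Finset.mem_filter, Finset.mem_sdiff, Finset.mem_product] at hp ⊢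
    tauto
  rw [Finset.card_sdiff_of_subset hgS] at hST
  have hgS' := Finset.card_le_card hgS
  have hle : (N - a).choose b ≤ N.choose b := Nat.choose_le_choose b (Nat.sub_le _ _)
  have hle' : N.choose a * (N - a).choose b ≤ N.choose a * N.choose b :=
    Nat.mul_le_mul_left _ hle
  have hc0 : 0 < N.choose a := Nat.choose_pos (by omega)
  have ht0 : 0 < (N - a).choose b := Nat.choose_pos (by omega)
  have hT0 : 0 < N.choose b := ht0.trans_le hle
  have hX : (S.card : ℝ) - g.card ≤ N.choose a * N.choose b - N.choose a * (N - a).choose b := by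
    have : S.card + N.choose a * (N - a).choose b ≤ N.choose a * N.choose b + g.card := by omega
    have := (Nat.cast_le (α := ℝ)).2 this
    push_cast at this
    linarith
  rify at hgt hgS' hle hle' hc0 ht0 hT0
  push_cast
  generalize (S.card : ℝ) = x at *
  generalize hy : (g.card : ℝ) = y at *
  have hy0 : 0 ≤ y := hy ▸ Nat.cast_nonneg _
  generalize (N.choose a : ℝ) = c at *
  generalize (N.choose b : ℝ) = T at *
  generalize ((N - a).choose b : ℝ) = t at *
  have hcT : 0 < c * T := by positivity
  have hct : 0 < c * t := by positivity
  have hid : 1 - t / T = (c * T - c * t) / (c * T) := by field_simp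
  have hyt : y / (c * t) ≤ 1 := (div_le_one hct).2 hgt
  have hyt0 : 0 ≤ y / (c * t) := by positivity
  have hdiff : x / (c * T) - y / (c * t) =
      (x - y) / (c * T) - y / (c * t) * ((c * T - c * t) / (c * T)) := by
    field_simp
    ring
  have h1 : (x - y) / (c * T) ≤ (c * T - c * t) / (c * T) := by gcongr
  have h2 : 0 ≤ (x - y) / (c * T) := div_nonneg (by linarith) hcT.le
  have h3 : 0 ≤ (c * T - c * t) / (c * T) := div_nonneg (by linarith) hcT.le
  rw [hid, hdiff, abs_le]
  constructor <;> nlinarith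

lemma tendsto_choose_sub_div_choose (a b : ℕ) :
    Tendsto (fun n : ℕ => ((n - a).choose b : ℝ) / (n.choose b : ℝ)) atTop (𝓝 1) := by
  rw [← tendsto_add_atTop_iff_nat a]
  simp only [Nat.add_sub_cancel]
  have h1 := isEquivalent_choose b
  have h2 := (isEquivalent_choose b).comp_tendsto (tendsto_add_atTop_nat a)
  have h3 : Tendsto (fun n : ℕ => ((n : ℝ) / (n + a)) ^ b) atTop (𝓝 1) := by
    simpa using (tendsto_natCast_div_add_atTop (a : ℝ)).pow b
  have h4 := (h1.div h2).symm.tendsto_nhds (c := 1) (h3.congr fun n => by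
    have : (b.factorial : ℝ) ≠ 0 := Nat.cast_ne_zero.2 b.factorial_ne_zero
    simp only [Pi.div_apply, Function.comp_apply]
    rw [div_div_div_cancel_right₀ this, div_pow]
    push_cast
    rfl)
  exact h4

theorem llimit_mul_decomposition (τ : FGraph) (k : ℕ) (hτ : τ.verts = Finset.Icc 1 k)
    (V : Finset ℕ) (hV : k ≤ V.card)
    (𝓗 : Finset (LGraph τ)) (hc : LCompleteOn τ V 𝓗)
    (H1 H2 : LGraph τ) (hsz : H1.G.verts.card + H2.G.verts.card - k ≤ V.card)
    (φ : LGraph τ → ℝ) (hφ : IsLimitLGraph φ) :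
    φ H1 * φ H2 = ∑ Hτ ∈ 𝓗, rvalL Hτ H1 H2 * φ Hτ := by
  obtain ⟨Gs, hinc, hlim⟩ := hφ
  have hk : τ.verts.card = k := by simp [hτ]
  have hsz' : H1.free.card + H2.free.card ≤ V.card - τ.verts.card := by
    have h1 := H1.card_le
    have h2 := H2.card_le
    rw [H1.card_free, H2.card_free]
    omega
  have hN : Tendsto (fun n => (Gs n).free.card) atTop atTop := by
    simp only [LGraph.card_free]
    exact (tendsto_sub_atTop_nat _).comp (strictMono_nat_of_lt_succ hinc).tendsto_atTop
  have hlhs := (hlim H1).mul (hlim H2)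
  have hrhs : Tendsto (fun n => ∑ H ∈ 𝓗, rvalL H H1 H2 * ldensity H (Gs n)) atTop
      (𝓝 (∑ H ∈ 𝓗, rvalL H H1 H2 * φ H)) :=
    tendsto_finsetSum _ fun H _ => (hlim H).const_mul _
  have hbound := ((tendsto_choose_sub_div_choose H1.free.card H2.free.card).comp hN).const_sub 1
  rw [sub_self] at hbound
  refine sub_eq_zero.1 (tendsto_nhds_unique (hlhs.sub hrhs) (squeeze_zero_norm' ?_ hbound))
  filter_upwards [hN.eventually_ge_atTop (V.card - τ.verts.card)] with n hn
  rw [sum_rvalL_mul_ldensity hc (hk ▸ hV) H1 H2 (Gs n) hsz' hn, Real.norm_eq_abs]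
  exact abs_ldensity_mul_sub_rvalL_le H1 H2 (Gs n) (hsz'.trans hn)
end

section
/- (Adjointness of the downward operator.) Let τ be a type of size k, let H^τ be a τ-labelled graph, and let G be a graph. Let Z_G be the number of embeddings θ of τ into G (equivalently, the number of τ-labelled graphs with underlying graph G). Then q_{H^τ} · p(|H^τ|, G) · Z_G = q_{(τ, id_{[k]})} · p(τ, G) · Σ_θ p_τ(H^τ, (G,θ)), where the sum ranges over all embeddings θ of τ into G. -/
open Filter Topology MeasureTheory

namespace FGraph

theorem exists_inverse_of_bijOn {H G : FGraph} {f : ℕ → ℕ}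
    (hf : Set.BijOn f ↑H.verts ↑G.verts)
    (hadj : ∀ a ∈ H.verts, ∀ b ∈ H.verts, (H.Adj a b ↔ G.Adj (f a) (f b))) :
    ∃ g : ℕ → ℕ, Set.BijOn g ↑G.verts ↑H.verts ∧
      (∀ a ∈ G.verts, ∀ b ∈ G.verts, (G.Adj a b ↔ H.Adj (g a) (g b))) ∧
      ∀ a ∈ H.verts, g (f a) = a := by
  have hinv := hf.invOn_invFunOn
  have hg := hinv.symm.bijOn hf.surjOn.mapsTo_invFunOn hf.mapsTo
  refine ⟨Function.invFunOn f ↑H.verts, hg, fun a ha b hb => ?_, fun a ha => hinv.1 ha⟩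
  rw [hadj _ (hg.mapsTo ha) _ (hg.mapsTo hb), hinv.2 ha, hinv.2 hb]

theorem Iso.symm {H G : FGraph} (h : Iso H G) : Iso G H := by
  obtain ⟨f, hf, hadj⟩ := h
  obtain ⟨g, hg, hadj', -⟩ := exists_inverse_of_bijOn hf hadj
  exact ⟨g, hg, hadj'⟩

theorem card_verts_of_bijOn {H G : FGraph} {f : ℕ → ℕ}
    (hf : Set.BijOn f ↑H.verts ↑G.verts) : H.verts.card = G.verts.card :=
  Finset.card_nbij f hf.mapsTo hf.injOn hf.surjOn

end FGraph

theorem LIsoPair.iso {τ H G : FGraph} {ι θ : ℕ → ℕ} (h : LIsoPair τ H ι G θ) :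
    FGraph.Iso H G := by
  obtain ⟨f, hf, hadj, -⟩ := h
  exact ⟨f, hf, hadj⟩

theorem LIsoPair.card_eq {τ H G : FGraph} {ι θ : ℕ → ℕ} (h : LIsoPair τ H ι G θ) :
    H.verts.card = G.verts.card := by
  obtain ⟨f, hf, -⟩ := h
  exact FGraph.card_verts_of_bijOn hf

theorem LIsoPair.symm {τ H G : FGraph} {ι θ : ℕ → ℕ} (hι : ∀ i ∈ τ.verts, ι i ∈ H.verts)
    (h : LIsoPair τ H ι G θ) : LIsoPair τ G θ H ι := by
  obtain ⟨f, hf, hadj, hlab⟩ := h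
  obtain ⟨g, hg, hadj', hgf⟩ := FGraph.exists_inverse_of_bijOn hf hadj
  exact ⟨g, hg, hadj', fun i hi => by rw [← hlab i hi, hgf _ (hι i hi)]⟩

theorem LIsoPair.isEmbOf {τ H G : FGraph} {ι θ : ℕ → ℕ} (hι : IsEmbOf τ H ι)
    (h : LIsoPair τ H ι G θ) : IsEmbOf τ G θ := by
  obtain ⟨f, hf, hadj, hlab⟩ := h
  obtain ⟨hmem, hinj, hτ⟩ := hι
  refine ⟨fun i hi => ?_, fun i hi j hj hij => ?_, fun i hi j hj => ?_⟩
  · rw [← hlab i hi]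
    exact hf.mapsTo (hmem i hi)
  · rw [← hlab i hi, ← hlab j hj] at hij
    exact hinj hi hj (hf.injOn (hmem i hi) (hmem j hj) hij)
  · rw [hτ i hi j hj, hadj _ (hmem i hi) _ (hmem j hj), hlab i hi, hlab j hj]

theorem IsEmbOf.of_induce {τ G : FGraph} {W : Finset ℕ} (hW : W ⊆ G.verts) {θ : ℕ → ℕ}
    (h : IsEmbOf τ (G.induce W) θ) : IsEmbOf τ G θ :=
  ⟨fun i hi => hW (h.1 i hi), h.2.1, fun i hi j hj =>
    (h.2.2 i hi j hj).trans ⟨fun hij => hij.2.2, fun hij => ⟨h.1 i hi, h.1 j hj, hij⟩⟩⟩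

theorem IsEmbOf.card_image {τ G : FGraph} {θ : ℕ → ℕ} (h : IsEmbOf τ G θ) :
    (τ.verts.image θ).card = τ.verts.card :=
  Finset.card_image_of_injOn h.2.1

theorem IsEmbOf.image_subset {τ G : FGraph} {θ : ℕ → ℕ} (h : IsEmbOf τ G θ) :
    τ.verts.image θ ⊆ G.verts :=
  Finset.image_subset_iff.2 h.1

theorem IsEmbOf.card_le {τ G : FGraph} {θ : ℕ → ℕ} (h : IsEmbOf τ G θ) :
    τ.verts.card ≤ G.verts.card :=
  h.card_image ▸ Finset.card_le_card h.image_subset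

theorem toFun_apply {V W : Finset ℕ} (f : ↥V → ↥W) (i : ↥V) : toFun f i = f i := by
  simp [toFun]

/-- The labellings `θ` of `G` for which `(G, θ)` is `τ`-isomorphic to `(H, ι)`, normalised to
vanish outside the vertex set of `τ`. -/
def labellings (τ H : FGraph) (ι : ℕ → ℕ) (G : FGraph) : Set (ℕ → ℕ) :=
  {θ | (∀ i ∉ τ.verts, θ i = 0) ∧ LIsoPair τ H ι G θ}

theorem image_toFun_eq_labellings {τ H G : FGraph} {ι : ℕ → ℕ} (hι : IsEmbOf τ H ι)
    {V : Finset ℕ} (hV : G.verts ⊆ V) :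
    (fun f : ↥τ.verts ↪ ↥V => toFun ⇑f) '' {f | LIsoPair τ H ι G (toFun ⇑f)} =
      labellings τ H ι G := by
  ext θ
  constructor
  · rintro ⟨f, hf, rfl⟩
    exact ⟨fun i hi => by simp [toFun, hi], hf⟩
  · rintro ⟨hθ, h⟩
    have hemb := h.isEmbOf hι
    let f : ↥τ.verts ↪ ↥V :=
      ⟨fun i => ⟨θ i, hV (hemb.1 i i.2)⟩, fun i j hij =>
        Subtype.ext (hemb.2.1 i.2 j.2 (Subtype.ext_iff.1 hij))⟩
    have hf : toFun ⇑f = θ := by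
      ext i
      by_cases hi : i ∈ τ.verts
      · exact toFun_apply ⇑f ⟨i, hi⟩
      · simp [toFun, hi, hθ i hi]
    exact ⟨f, by simpa only [Set.mem_ofPred_eq, hf] using h, hf⟩

theorem finite_labellings {τ H G : FGraph} {ι : ℕ → ℕ} (hι : IsEmbOf τ H ι) :
    (labellings τ H ι G).Finite :=
  image_toFun_eq_labellings hι (Finset.Subset.refl G.verts) ▸ (Set.toFinite _).image _

theorem toFun_embedding_injective {V W : Finset ℕ} :
    Function.Injective fun f : ↥V ↪ ↥W => toFun ⇑f := by
  intro f g hfg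
  ext i
  rw [← toFun_apply, ← toFun_apply]
  exact congrFun hfg i

open Classical in
theorem card_filter_eq_ncard_labellings {τ H G : FGraph} {ι : ℕ → ℕ} (hι : IsEmbOf τ H ι)
    {V : Finset ℕ} (hV : G.verts ⊆ V) :
    (Finset.univ.filter fun f : ↥τ.verts ↪ ↥V => LIsoPair τ H ι G (toFun ⇑f)).card =
      (labellings τ H ι G).ncard := by
  rw [← image_toFun_eq_labellings hι hV, Set.ncard_image_of_injective _ toFun_embedding_injective,
    ← Set.ncard_coe_finset]
  simp

theorem ncard_labellings_le_of_iso {τ H G G' : FGraph} {ι : ℕ → ℕ} (hι : IsEmbOf τ H ι)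
    (h : FGraph.Iso G G') :
    (labellings τ H ι G).ncard ≤ (labellings τ H ι G').ncard := by
  classical
  obtain ⟨g, hg, hadj⟩ := h
  refine Set.ncard_le_ncard_of_injOn (fun θ i => if i ∈ τ.verts then g (θ i) else 0) ?_ ?_
    (finite_labellings hι)
  · rintro θ ⟨-, f, hf, hfadj, hlab⟩
    refine ⟨fun i hi => if_neg hi, g ∘ f, hg.comp hf, fun a ha b hb => ?_, fun i hi => ?_⟩
    · exact (hfadj a ha b hb).trans (hadj _ (hf.mapsTo ha) _ (hf.mapsTo hb))
    · simp [hi, hlab i hi]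
  · rintro θ ⟨hθ, hLθ⟩ θ' ⟨hθ', hLθ'⟩ heq
    ext i
    by_cases hi : i ∈ τ.verts
    · have := congrFun heq i
      simp only [hi, if_true] at this
      exact hg.injOn ((hLθ.isEmbOf hι).1 i hi) ((hLθ'.isEmbOf hι).1 i hi) this
    · rw [hθ i hi, hθ' i hi]

theorem ncard_labellings_eq_of_iso {τ H G G' : FGraph} {ι : ℕ → ℕ} (hι : IsEmbOf τ H ι)
    (h : FGraph.Iso G G') :
    (labellings τ H ι G).ncard = (labellings τ H ι G').ncard :=
  (ncard_labellings_le_of_iso hι h).antisymm (ncard_labellings_le_of_iso hι h.symm)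

theorem qval_eq {τ : FGraph} (Hτ : LGraph τ) :
    qval Hτ = ((labellings τ Hτ.G Hτ.θ Hτ.G).ncard : ℝ) /
      (Hτ.G.verts.card.descFactorial τ.verts.card : ℝ) := by
  classical
  rw [qval, Fintype.card_embedding_eq, Fintype.card_coe, Fintype.card_coe,
    ← card_filter_eq_ncard_labellings Hτ.emb (Finset.Subset.refl _), Fintype.card_subtype]
  congr 3
  ext f
  simp only [Finset.mem_filter, Finset.mem_univ, true_and]
  exact ⟨fun h => h.2.symm h.1.1, fun h => ⟨h.isEmbOf Hτ.emb, h.symm Hτ.emb.1⟩⟩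

open Classical in
theorem card_extensions_eq {τ G : FGraph} (Hτ : LGraph τ) {θ : ℕ → ℕ} (hθ : IsEmbOf τ G θ) :
    (((G.verts \ τ.verts.image θ).powersetCard (Hτ.G.verts.card - τ.verts.card)).filter
      fun U => LIsoPair τ Hτ.G Hτ.θ (G.induce (τ.verts.image θ ∪ U)) θ).card =
    ((G.verts.powersetCard Hτ.G.verts.card).filter
      fun W => LIsoPair τ Hτ.G Hτ.θ (G.induce W) θ).card := by
  refine Finset.card_nbij' (fun U => τ.verts.image θ ∪ U) (fun W => W \ τ.verts.image θ) ?_ ?_ ?_ ?_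
  · intro U hU
    simp only [Finset.coe_filter, Finset.mem_powersetCard, Set.mem_ofPred_eq] at hU ⊢
    refine ⟨⟨Finset.union_subset hθ.image_subset (hU.1.1.trans Finset.sdiff_subset), ?_⟩, hU.2⟩
    exact hU.2.card_eq.symm
  · intro W hW
    simp only [Finset.coe_filter, Finset.mem_powersetCard, Set.mem_ofPred_eq] at hW ⊢
    have him : τ.verts.image θ ⊆ W := (hW.2.isEmbOf Hτ.emb).image_subset
    refine ⟨⟨Finset.sdiff_subset_sdiff hW.1.1 (Finset.Subset.refl _), ?_⟩, ?_⟩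
    · rw [Finset.card_sdiff_of_subset him, hθ.card_image, hW.1.2]
    · rw [Finset.union_sdiff_of_subset him]
      exact hW.2
  · intro U hU
    simp only [Finset.coe_filter, Finset.mem_powersetCard, Set.mem_ofPred_eq] at hU
    exact Finset.union_sdiff_cancel_left
      (Finset.disjoint_sdiff.mono_right hU.1.1)
  · intro W hW
    simp only [Finset.coe_filter, Finset.mem_powersetCard, Set.mem_ofPred_eq] at hW
    exact Finset.union_sdiff_of_subset (hW.2.isEmbOf Hτ.emb).image_subset

open Classical in
/-- Double counting of the pairs `(W, θ)` with `(G[W], θ)` `τ`-isomorphic to `Hτ`. -/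
theorem sum_card_extensions {τ : FGraph} (Hτ : LGraph τ) (G : FGraph) :
    ∑ f : {f : ↥τ.verts ↪ ↥G.verts // IsEmbOf τ G (toFun ⇑f)},
      ((G.verts.powersetCard Hτ.G.verts.card).filter
        fun W => LIsoPair τ Hτ.G Hτ.θ (G.induce W) (toFun ⇑f.1)).card =
    (labellings τ Hτ.G Hτ.θ Hτ.G).ncard *
      ((G.verts.powersetCard Hτ.G.verts.card).filter
        fun W => FGraph.Iso Hτ.G (G.induce W)).card := by
  have hswap := Finset.sum_card_bipartiteAbove_eq_sum_card_bipartiteBelow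
    (s := (Finset.univ : Finset {f : ↥τ.verts ↪ ↥G.verts // IsEmbOf τ G (toFun ⇑f)}))
    (t := G.verts.powersetCard Hτ.G.verts.card)
    (fun (f : {f : ↥τ.verts ↪ ↥G.verts // IsEmbOf τ G (toFun ⇑f)}) W =>
      LIsoPair τ Hτ.G Hτ.θ (G.induce W) (toFun ⇑f.1))
  simp only [Finset.bipartiteAbove, Finset.bipartiteBelow] at hswap
  rw [hswap, Finset.card_filter, Finset.mul_sum]
  refine Finset.sum_congr rfl fun W hW => ?_
  have hWG : W ⊆ G.verts := (Finset.mem_powersetCard.1 hW).1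
  split_ifs with hiso
  · rw [mul_one, ncard_labellings_eq_of_iso Hτ.emb hiso,
      ← card_filter_eq_ncard_labellings Hτ.emb (V := G.verts) hWG]
    refine Finset.card_nbij Subtype.val (fun f hf => ?_) Subtype.val_injective.injOn
      fun f hf => ?_
    · simpa using hf
    · have hf : LIsoPair τ Hτ.G Hτ.θ (G.induce W) (toFun ⇑f) := by simpa using hf
      exact ⟨⟨f, (hf.isEmbOf Hτ.emb).of_induce hWG⟩, by simpa using hf, rfl⟩
  · rw [mul_zero, Finset.card_eq_zero, Finset.filter_eq_empty_iff]
    exact fun f _ hf => hiso hf.iso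

open Classical in
theorem embCard_eq (τ G : FGraph) :
    embCard τ G = (labellings τ τ id τ).ncard *
      ((G.verts.powersetCard τ.verts.card).filter fun W => FGraph.Iso τ (G.induce W)).card := by
  refine Eq.trans ?_ (sum_card_extensions (idLabel τ) G)
  rw [embCard, ← Finset.card_univ, Finset.card_eq_sum_ones]
  refine Finset.sum_congr rfl fun f _ => ?_
  rw [← card_extensions_eq (idLabel τ) f.2, idLabel, Nat.sub_self, Finset.powersetCard_zero, Finset.filter_singleton, if_pos,
    Finset.card_singleton]
  have hf := f.2
  rw [Finset.union_empty]
  refine ⟨toFun ⇑f.1, ?_, fun a ha b hb => ?_, fun i _ => rfl⟩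
  · have him : ((G.induce (τ.verts.image (toFun ⇑f.1))).verts : Set ℕ) =
        toFun ⇑f.1 '' ↑τ.verts := Finset.coe_image
    rw [him]
    exact hf.2.1.bijOn_image
  · exact (hf.2.2 a ha b hb).trans
      ⟨fun h => ⟨Finset.mem_image_of_mem _ ha, Finset.mem_image_of_mem _ hb, h⟩, fun h => h.2.2⟩

open Classical in
theorem sum_ldensity {τ : FGraph} (Hτ : LGraph τ) (G : FGraph) :
    ∑ f : {f : ↥τ.verts ↪ ↥G.verts // IsEmbOf τ G (toFun ⇑f)},
      ldensity Hτ (LGraph.mk' τ G (toFun ⇑f.1) f.2) =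
    ((labellings τ Hτ.G Hτ.θ Hτ.G).ncard : ℝ) *
      ((G.verts.powersetCard Hτ.G.verts.card).filter
        fun W => FGraph.Iso Hτ.G (G.induce W)).card /
      ((G.verts.card - τ.verts.card).choose (Hτ.G.verts.card - τ.verts.card) : ℝ) := by
  rw [← Nat.cast_mul, ← sum_card_extensions, Nat.cast_sum, Finset.sum_div]
  refine Finset.sum_congr rfl fun f _ => ?_
  rw [← card_extensions_eq Hτ f.2]
  rw [ldensity, LGraph.mk', Finset.card_powersetCard,
    Finset.card_sdiff_of_subset f.2.image_subset, f.2.card_image]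

theorem descFactorial_mul_choose {n h k : ℕ} (hkh : k ≤ h) (hkn : k ≤ n) :
    h.descFactorial k * n.choose h =
      k.descFactorial k * n.choose k * (n - k).choose (h - k) := by
  rcases le_or_gt h n with hhn | hhn
  · rw [Nat.descFactorial_self, Nat.descFactorial_eq_factorial_mul_choose, mul_assoc, mul_assoc,
      mul_comm (h.choose k), Nat.choose_mul hkh]
  · rw [Nat.choose_eq_zero_of_lt hhn, Nat.choose_eq_zero_of_lt (by omega : n - k < h - k),
      mul_zero, mul_zero]

open Classical in
theorem downward_adjoint (τ : FGraph) (k : ℕ) (hτ : τ.verts = Finset.Icc 1 k)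
    (Hτ : LGraph τ) (G : FGraph) :
    qval Hτ * FGraph.density Hτ.G G * (embCard τ G : ℝ) =
      qval (idLabel τ) * FGraph.density τ G *
        ∑ f : {f : ↥τ.verts ↪ ↥G.verts // IsEmbOf τ G (toFun ⇑f)},
          ldensity Hτ (LGraph.mk' τ G (toFun ⇑f.1) f.2) := by
  rcases Nat.eq_zero_or_pos (embCard τ G) with hZ | hZ
  · have hempty : IsEmpty {f : ↥τ.verts ↪ ↥G.verts // IsEmbOf τ G (toFun ⇑f)} :=
      Fintype.card_eq_zero_iff.1 hZ
    simp [hZ]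
  obtain ⟨f⟩ : Nonempty {f : ↥τ.verts ↪ ↥G.verts // IsEmbOf τ G (toFun ⇑f)} :=
    Fintype.card_pos_iff.1 hZ
  have hchoose := descFactorial_mul_choose Hτ.emb.card_le f.2.card_le
  have hchoose' := congrArg (Nat.cast : ℕ → ℝ) hchoose
  push_cast at hchoose'
  have hid : (idLabel τ).G = τ := rfl
  have hidθ : (idLabel τ).θ = id := rfl
  rw [sum_ldensity, qval_eq, qval_eq, embCard_eq, FGraph.density, FGraph.density,
    Finset.card_powersetCard, Finset.card_powersetCard, hid, hidθ, Nat.cast_mul,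
    div_mul_div_comm, div_mul_div_comm, div_mul_div_comm, div_mul_eq_mul_div, hchoose']
  ring
end
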